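/- arXiv:2307.12581 — 8 statements merged into one kernel-verified Lean document; each statement's English description precedes it below -/
import Mathlib

section
/- Let n ≥ 1 and let J be a random symmetric n×n real matrix whose law is orthogonally invariant, i.e., Q J Qᵀ has the same distribution as J for every fixed orthogonal matrix Q ∈ O(n). Assume that p(J) and p^S(J) are integrable. Then E[p(J)] ≤ E[p^S(J)]. -/
open MeasureTheory Matrix Real Filter

/-- The quadratic form `xᵀ J x`. -/
noncomputable def qf {n : ℕ} (J : Matrix (Fin n) (Fin n) ℝ) (x : Fin n → ℝ) : ℝ :=
  ∑ i, ∑ j, x i * J i j * x j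

/-- The `±1` vector associated to a boolean vector; these enumerate `{-1,1}ⁿ`. -/
noncomputable def sgn {n : ℕ} (b : Fin n → Bool) : Fin n → ℝ :=
  fun i => if b i then 1 else -1

/-- Normalized Ising partition function `Ẑ(J) = 2⁻ⁿ ∑_{x ∈ {-1,1}ⁿ} exp(½ xᵀJx)`. -/
noncomputable def isingZ {n : ℕ} (J : Matrix (Fin n) (Fin n) ℝ) : ℝ :=
  ((2 : ℝ) ^ n)⁻¹ * ∑ b : Fin n → Bool, Real.exp ((1 / 2) * qf J (sgn b))

/-- Ising pressure `p(J) = n⁻¹ log Ẑ(J)`. -/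
noncomputable def isingP {n : ℕ} (J : Matrix (Fin n) (Fin n) ℝ) : ℝ :=
  (n : ℝ)⁻¹ * Real.log (isingZ J)

/-- The uniform (rotation-invariant) probability measure on the sphere of radius `√n`
in Euclidean `ℝⁿ`: the rotation-invariant surface measure on the unit sphere,
normalized to a probability measure and pushed forward by scaling by `√n`. -/
noncomputable def unifSphere (n : ℕ) : Measure (EuclideanSpace ℝ (Fin n)) :=
  Measure.map (fun x : Metric.sphere (0 : EuclideanSpace ℝ (Fin n)) 1 =>
      (Real.sqrt n) • (x : EuclideanSpace ℝ (Fin n)))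
    (((volume : Measure (EuclideanSpace ℝ (Fin n))).toSphere Set.univ)⁻¹ •
      (volume : Measure (EuclideanSpace ℝ (Fin n))).toSphere)

/-- Spherical normalized partition function `Ẑ^S(J) = E_{x ~ Unif(S^{n-1}(√n))} exp(½ xᵀJx)`. -/
noncomputable def sphZ {n : ℕ} (J : Matrix (Fin n) (Fin n) ℝ) : ℝ :=
  ∫ x, Real.exp ((1 / 2) * qf J (fun i => x i)) ∂(unifSphere n)

/-- Spherical pressure `p^S(J) = n⁻¹ log Ẑ^S(J)`. -/
noncomputable def sphP {n : ℕ} (J : Matrix (Fin n) (Fin n) ℝ) : ℝ :=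
  (n : ℝ)⁻¹ * Real.log (sphZ J)

noncomputable instance {n : ℕ} : MeasurableSpace (Matrix (Fin n) (Fin n) ℝ) :=
  inferInstanceAs (MeasurableSpace (Fin n → Fin n → ℝ))

open scoped Pointwise ENNReal

section SphereInvariance

variable {E : Type*} [NormedAddCommGroup E] [InnerProductSpace ℝ E]

/-- The self-map of the unit sphere induced by a linear isometry equivalence. -/
def unitSphereMap (e : E ≃ₗᵢ[ℝ] E) (x : Metric.sphere (0 : E) 1) : Metric.sphere (0 : E) 1 :=
  ⟨e x, by simp⟩

lemma continuous_unitSphereMap (e : E ≃ₗᵢ[ℝ] E) : Continuous (unitSphereMap e) :=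
  (e.continuous.comp continuous_subtype_val).subtype_mk _

lemma preimage_smul_image_sphere (e : E ≃ₗᵢ[ℝ] E) (s : Set (Metric.sphere (0 : E) 1)) :
    e ⁻¹' (Set.Ioo (0 : ℝ) 1 • ((↑) '' s)) =
      Set.Ioo (0 : ℝ) 1 • ((↑) '' (unitSphereMap e ⁻¹' s)) := by
  ext x
  simp only [Set.mem_preimage, Set.mem_smul, Set.mem_image]
  constructor
  · rintro ⟨r, hr, -, ⟨z, hz, rfl⟩, hx⟩
    refine ⟨r, hr, _, ⟨⟨e.symm z, by simp⟩, ?_, rfl⟩, ?_⟩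
    · simpa [unitSphereMap] using hz
    · apply e.injective
      simpa using hx
  · rintro ⟨r, hr, -, ⟨z, hz, rfl⟩, rfl⟩
    exact ⟨r, hr, _, ⟨_, hz, rfl⟩, by simp [unitSphereMap]⟩

lemma map_unitSphereMap_toSphere [MeasurableSpace E] [BorelSpace E] [FiniteDimensional ℝ E]
    (e : E ≃ₗᵢ[ℝ] E) :
    Measure.map (unitSphereMap e) (volume : Measure E).toSphere =
      (volume : Measure E).toSphere := by
  have hm := (continuous_unitSphereMap e).measurable
  ext s hs
  rw [Measure.map_apply hm hs, Measure.toSphere_apply' _ (hm hs), Measure.toSphere_apply' _ hs,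
    ← preimage_smul_image_sphere]
  congr 1
  exact e.measurePreserving.measure_preimage_equiv (f := e.toHomeomorph.toMeasurableEquiv) _

end SphereInvariance

section UnifSphere

variable {n : ℕ}

lemma measurable_sqrt_smul_sphere : Measurable
    (fun x : Metric.sphere (0 : EuclideanSpace ℝ (Fin n)) 1 =>
      (Real.sqrt n) • (x : EuclideanSpace ℝ (Fin n))) :=
  (continuous_subtype_val.const_smul (Real.sqrt n)).measurable

lemma map_unifSphere (e : EuclideanSpace ℝ (Fin n) ≃ₗᵢ[ℝ] EuclideanSpace ℝ (Fin n)) :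
    Measure.map e (unifSphere n) = unifSphere n := by
  have he : Measurable e := e.continuous.measurable
  rw [unifSphere, Measure.map_map he measurable_sqrt_smul_sphere]
  conv_rhs => rw [← map_unitSphereMap_toSphere e, Measure.map_apply
    (continuous_unitSphereMap e).measurable .univ, Set.preimage_univ]
  rw [← Measure.map_smul, Measure.map_map measurable_sqrt_smul_sphere
    (continuous_unitSphereMap e).measurable]
  congr 1
  ext1 x
  simp [unitSphereMap]

lemma isProbabilityMeasure_unifSphere (hn : 1 ≤ n) : IsProbabilityMeasure (unifSphere n) := by
  have : Nonempty (Fin n) := ⟨⟨0, hn⟩⟩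
  have : NeZero (volume : Measure (EuclideanSpace ℝ (Fin n))).toSphere :=
    ⟨Measure.toSphere_ne_zero _⟩
  exact Measure.isProbabilityMeasure_map measurable_sqrt_smul_sphere.aemeasurable

lemma ae_norm_unifSphere : ∀ᵐ x ∂(unifSphere n), ‖x‖ = Real.sqrt n := by
  refine (ae_map_iff measurable_sqrt_smul_sphere.aemeasurable
    (measurableSet_eq_fun measurable_norm measurable_const)).2 (Eventually.of_forall fun x => ?_)
  simp [norm_smul]

end UnifSphere

section QuadraticForm

variable {n : ℕ}

lemma qf_eq_dotProduct (J : Matrix (Fin n) (Fin n) ℝ) (x : Fin n → ℝ) :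
    qf J x = x ⬝ᵥ J *ᵥ x := by
  simp [qf, dotProduct, mulVec, Finset.mul_sum, mul_assoc]

lemma qf_conj (Q J : Matrix (Fin n) (Fin n) ℝ) (x : Fin n → ℝ) :
    qf (Qᵀ * J * Q) x = qf J (Q *ᵥ x) := by
  rw [qf_eq_dotProduct, qf_eq_dotProduct, ← mulVec_mulVec, ← mulVec_mulVec, dotProduct_mulVec,
    vecMul_transpose]

/-- The matrix of a linear isometry equivalence of Euclidean space. -/
noncomputable def isometryMatrix
    (e : EuclideanSpace ℝ (Fin n) ≃ₗᵢ[ℝ] EuclideanSpace ℝ (Fin n)) :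
    Matrix (Fin n) (Fin n) ℝ :=
  LinearMap.toMatrix (EuclideanSpace.basisFun (Fin n) ℝ).toBasis
    (EuclideanSpace.basisFun (Fin n) ℝ).toBasis e.toLinearEquiv

lemma isometryMatrix_mulVec
    (e : EuclideanSpace ℝ (Fin n) ≃ₗᵢ[ℝ] EuclideanSpace ℝ (Fin n))
    (x : EuclideanSpace ℝ (Fin n)) : isometryMatrix e *ᵥ x.ofLp = (e x).ofLp := by
  have := LinearMap.toMatrix_mulVec_repr (EuclideanSpace.basisFun (Fin n) ℝ).toBasis
    (EuclideanSpace.basisFun (Fin n) ℝ).toBasis (e.toLinearEquiv : _ →ₗ[ℝ] _) x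
  have hrepr : ⇑((EuclideanSpace.basisFun (Fin n) ℝ).toBasis.repr x) = x.ofLp := by
    ext i
    simp
  ext i
  simpa [isometryMatrix, hrepr] using congrFun this i

lemma isometryMatrix_mul_transpose
    (e : EuclideanSpace ℝ (Fin n) ≃ₗᵢ[ℝ] EuclideanSpace ℝ (Fin n)) :
    isometryMatrix e * (isometryMatrix e)ᵀ = 1 := by
  have := e.toMatrix_mem_unitaryGroup (EuclideanSpace.basisFun (Fin n) ℝ)
    (EuclideanSpace.basisFun (Fin n) ℝ)
  simpa [isometryMatrix, star_eq_conjTranspose, conjTranspose_eq_transpose_of_trivial] using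
    Matrix.mem_unitaryGroup_iff.1 this

lemma measurable_entry (i j : Fin n) :
    Measurable (fun J : Matrix (Fin n) (Fin n) ℝ => J i j) :=
  (measurable_pi_apply j).comp (measurable_pi_apply (X := fun _ : Fin n => Fin n → ℝ) i)

lemma measurable_conj (A B : Matrix (Fin n) (Fin n) ℝ) :
    Measurable (fun J : Matrix (Fin n) (Fin n) ℝ => A * J * B) := by
  refine measurable_pi_lambda (X := fun _ : Fin n => Fin n → ℝ) _ fun i =>
    measurable_pi_lambda _ fun j => ?_
  simp only [mul_apply]
  exact Finset.measurable_sum _ fun k _ => (Finset.measurable_sum _ fun l _ =>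
    (measurable_entry l k).const_mul _).mul_const _

/-- The Gibbs weight `exp (½ xᵀ J x)`, with values in `ℝ≥0∞`. -/
noncomputable def gibbsWeight (J : Matrix (Fin n) (Fin n) ℝ) (x : EuclideanSpace ℝ (Fin n)) :
    ℝ≥0∞ :=
  ENNReal.ofReal (Real.exp ((1 / 2) * qf J x.ofLp))

lemma measurable_gibbsWeight : Measurable (fun p : Matrix (Fin n) (Fin n) ℝ ×
    EuclideanSpace ℝ (Fin n) => gibbsWeight p.1 p.2) := by
  have hx (i : Fin n) : Measurable (fun p : Matrix (Fin n) (Fin n) ℝ ×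
      EuclideanSpace ℝ (Fin n) => p.2.ofLp i) := by fun_prop
  refine ENNReal.measurable_ofReal.comp (Real.measurable_exp.comp (Measurable.const_mul ?_ _))
  exact Finset.measurable_sum _ fun i _ => Finset.measurable_sum _ fun j _ =>
    ((hx i).mul ((measurable_entry i j).comp measurable_fst)).mul (hx j)

lemma measurable_gibbsWeight_right (J : Matrix (Fin n) (Fin n) ℝ) :
    Measurable (gibbsWeight J) := by
  unfold gibbsWeight qf
  fun_prop

lemma gibbsWeight_conj (e : EuclideanSpace ℝ (Fin n) ≃ₗᵢ[ℝ] EuclideanSpace ℝ (Fin n))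
    (J : Matrix (Fin n) (Fin n) ℝ) (x : EuclideanSpace ℝ (Fin n)) :
    gibbsWeight ((isometryMatrix e)ᵀ * J * isometryMatrix e) x = gibbsWeight J (e x) := by
  simp only [gibbsWeight, qf_conj, isometryMatrix_mulVec]

end QuadraticForm

section SphericalPartitionFunction

variable {n : ℕ}

lemma integrable_exp_qf (hn : 1 ≤ n) (J : Matrix (Fin n) (Fin n) ℝ) :
    Integrable (fun x : EuclideanSpace ℝ (Fin n) => Real.exp ((1 / 2) * qf J (fun i => x i)))
      (unifSphere n) := by
  have := isProbabilityMeasure_unifSphere hn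
  have hc : Continuous
      (fun x : EuclideanSpace ℝ (Fin n) => Real.exp ((1 / 2) * qf J (fun i => x i))) := by
    unfold qf
    fun_prop
  obtain ⟨C, hC⟩ := (isCompact_sphere (0 : EuclideanSpace ℝ (Fin n))
    (Real.sqrt n)).exists_bound_of_continuousOn hc.continuousOn
  refine Integrable.of_bound hc.aestronglyMeasurable C ?_
  filter_upwards [ae_norm_unifSphere] with x hx
  exact hC x (by simpa using hx)

lemma sphZ_pos (hn : 1 ≤ n) (J : Matrix (Fin n) (Fin n) ℝ) : 0 < sphZ J := by
  have := isProbabilityMeasure_unifSphere hn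
  exact integral_exp_pos (integrable_exp_qf hn J)

lemma ofReal_sphZ (hn : 1 ≤ n) (J : Matrix (Fin n) (Fin n) ℝ) :
    ENNReal.ofReal (sphZ J) = ∫⁻ x, gibbsWeight J x ∂(unifSphere n) :=
  ofReal_integral_eq_lintegral_ofReal (integrable_exp_qf hn J)
    (Eventually.of_forall fun _ => (Real.exp_pos _).le)

lemma lintegral_gibbsWeight_conj
    (e : EuclideanSpace ℝ (Fin n) ≃ₗᵢ[ℝ] EuclideanSpace ℝ (Fin n))
    (J : Matrix (Fin n) (Fin n) ℝ) :
    ∫⁻ x, gibbsWeight ((isometryMatrix e)ᵀ * J * isometryMatrix e) x ∂(unifSphere n) =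
      ∫⁻ x, gibbsWeight J x ∂(unifSphere n) := by
  simp only [gibbsWeight_conj]
  conv_rhs => rw [← map_unifSphere e]
  rw [lintegral_map (measurable_gibbsWeight_right J) e.continuous.measurable]

lemma measurable_ofReal_sphZ (hn : 1 ≤ n) :
    Measurable (fun J : Matrix (Fin n) (Fin n) ℝ => ENNReal.ofReal (sphZ J)) := by
  have := isProbabilityMeasure_unifSphere hn
  simp only [ofReal_sphZ hn]
  exact measurable_gibbsWeight.lintegral_prod_right'

end SphericalPartitionFunction

section GibbsRatio

variable {n : ℕ} (μ : Measure (Matrix (Fin n) (Fin n) ℝ))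

lemma measurable_gibbsWeight_div_sphZ (hn : 1 ≤ n) : Measurable
    (fun p : Matrix (Fin n) (Fin n) ℝ × EuclideanSpace ℝ (Fin n) =>
      gibbsWeight p.1 p.2 / ENNReal.ofReal (sphZ p.1)) :=
  measurable_gibbsWeight.div ((measurable_ofReal_sphZ hn).comp measurable_fst)

lemma measurable_gibbsWeight_div_sphZ_left (hn : 1 ≤ n) (y : EuclideanSpace ℝ (Fin n)) :
    Measurable (fun J : Matrix (Fin n) (Fin n) ℝ => gibbsWeight J y / ENNReal.ofReal (sphZ J)) := by
  have hy : Measurable (fun J : Matrix (Fin n) (Fin n) ℝ => (J, y)) :=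
    measurable_id.prodMk measurable_const
  have hw := measurable_gibbsWeight.comp hy
  exact hw.div (measurable_ofReal_sphZ hn)

lemma lintegral_gibbs_ratio_isometry (hn : 1 ≤ n)
    (hinv : ∀ Q : Matrix (Fin n) (Fin n) ℝ, Qᵀ * Q = 1 →
      Measure.map (fun J => Q * J * Qᵀ) μ = μ)
    (e : EuclideanSpace ℝ (Fin n) ≃ₗᵢ[ℝ] EuclideanSpace ℝ (Fin n))
    (y : EuclideanSpace ℝ (Fin n)) :
    ∫⁻ J, gibbsWeight J (e y) / ENNReal.ofReal (sphZ J) ∂μ =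
      ∫⁻ J, gibbsWeight J y / ENNReal.ofReal (sphZ J) ∂μ := by
  have hQ := hinv (isometryMatrix e)ᵀ (by
    rw [transpose_transpose, isometryMatrix_mul_transpose])
  rw [transpose_transpose] at hQ
  conv_rhs => rw [← hQ]
  rw [lintegral_map (measurable_gibbsWeight_div_sphZ_left hn y) (measurable_conj _ _)]
  simp only [ofReal_sphZ hn, lintegral_gibbsWeight_conj]
  simp only [gibbsWeight_conj]

lemma lintegral_gibbs_ratio_congr_norm (hn : 1 ≤ n)
    (hinv : ∀ Q : Matrix (Fin n) (Fin n) ℝ, Qᵀ * Q = 1 →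
      Measure.map (fun J => Q * J * Qᵀ) μ = μ)
    {x y : EuclideanSpace ℝ (Fin n)} (hxy : ‖x‖ = ‖y‖) :
    ∫⁻ J, gibbsWeight J x / ENNReal.ofReal (sphZ J) ∂μ =
      ∫⁻ J, gibbsWeight J y / ENNReal.ofReal (sphZ J) ∂μ := by
  rw [← lintegral_gibbs_ratio_isometry μ hn hinv (Submodule.reflection (ℝ ∙ (x - y))ᗮ) x,
    Submodule.reflection_sub hxy]

lemma lintegral_gibbs_ratio_eq_one [IsProbabilityMeasure μ] (hn : 1 ≤ n)
    (hinv : ∀ Q : Matrix (Fin n) (Fin n) ℝ, Qᵀ * Q = 1 →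
      Measure.map (fun J => Q * J * Qᵀ) μ = μ)
    {x : EuclideanSpace ℝ (Fin n)} (hx : ‖x‖ = Real.sqrt n) :
    ∫⁻ J, gibbsWeight J x / ENNReal.ofReal (sphZ J) ∂μ = 1 := by
  have := isProbabilityMeasure_unifSphere hn
  calc ∫⁻ J, gibbsWeight J x / ENNReal.ofReal (sphZ J) ∂μ
      = ∫⁻ _y, ∫⁻ J, gibbsWeight J x / ENNReal.ofReal (sphZ J) ∂μ ∂(unifSphere n) := by simp
    _ = ∫⁻ y, ∫⁻ J, gibbsWeight J y / ENNReal.ofReal (sphZ J) ∂μ ∂(unifSphere n) := by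
      refine lintegral_congr_ae ?_
      filter_upwards [ae_norm_unifSphere] with y hy
      exact lintegral_gibbs_ratio_congr_norm μ hn hinv (hx.trans hy.symm)
    _ = ∫⁻ J, ∫⁻ y, gibbsWeight J y / ENNReal.ofReal (sphZ J) ∂(unifSphere n) ∂μ :=
      lintegral_lintegral_swap
        ((measurable_gibbsWeight_div_sphZ hn).comp measurable_swap).aemeasurable
    _ = ∫⁻ _J, 1 ∂μ := by
      refine lintegral_congr fun J => ?_
      simp only [div_eq_mul_inv]
      rw [lintegral_mul_const _ (measurable_gibbsWeight_right J), ← ofReal_sphZ hn]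
      exact ENNReal.mul_inv_cancel (by simpa using sphZ_pos hn J) ENNReal.ofReal_ne_top
    _ = 1 := by simp

lemma norm_toLp_sgn (b : Fin n → Bool) : ‖WithLp.toLp 2 (sgn b)‖ = Real.sqrt n := by
  have h (i : Fin n) : ‖sgn b i‖ ^ 2 = 1 := by
    unfold sgn
    split <;> simp
  simp [EuclideanSpace.norm_eq, -Real.norm_eq_abs, h]

lemma isingZ_pos (J : Matrix (Fin n) (Fin n) ℝ) : 0 < isingZ J :=
  mul_pos (by positivity) (Finset.sum_pos (fun _ _ => Real.exp_pos _) Finset.univ_nonempty)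

lemma ofReal_isingZ_div_sphZ (hn : 1 ≤ n) (J : Matrix (Fin n) (Fin n) ℝ) :
    ENNReal.ofReal (isingZ J / sphZ J) = ENNReal.ofReal ((2 : ℝ) ^ n)⁻¹ *
      ∑ b : Fin n → Bool, gibbsWeight J (WithLp.toLp 2 (sgn b)) / ENNReal.ofReal (sphZ J) := by
  rw [isingZ, mul_div_assoc, ENNReal.ofReal_mul (by positivity), Finset.sum_div,
    ENNReal.ofReal_sum_of_nonneg fun b _ => div_nonneg (Real.exp_pos _).le (sphZ_pos hn J).le]
  simp only [ENNReal.ofReal_div_of_pos (sphZ_pos hn J), gibbsWeight]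

lemma measurable_ofReal_isingZ_div_sphZ (hn : 1 ≤ n) :
    Measurable (fun J : Matrix (Fin n) (Fin n) ℝ => ENNReal.ofReal (isingZ J / sphZ J)) := by
  simp only [ofReal_isingZ_div_sphZ hn]
  exact (Finset.measurable_sum _ fun b _ =>
    measurable_gibbsWeight_div_sphZ_left hn _).const_mul _

lemma lintegral_isingZ_div_sphZ [IsProbabilityMeasure μ] (hn : 1 ≤ n)
    (hinv : ∀ Q : Matrix (Fin n) (Fin n) ℝ, Qᵀ * Q = 1 →
      Measure.map (fun J => Q * J * Qᵀ) μ = μ) :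
    ∫⁻ J, ENNReal.ofReal (isingZ J / sphZ J) ∂μ = 1 := by
  have hm (b : Fin n → Bool) := measurable_gibbsWeight_div_sphZ_left hn (WithLp.toLp 2 (sgn b))
  simp only [ofReal_isingZ_div_sphZ hn]
  rw [lintegral_const_mul _ (Finset.measurable_sum _ fun b _ => hm b),
    lintegral_finsetSum _ fun b _ => hm b]
  simp only [lintegral_gibbs_ratio_eq_one μ hn hinv (norm_toLp_sgn _)]
  rw [ENNReal.ofReal_inv_of_pos (by positivity), ENNReal.ofReal_pow (by norm_num)]
  simp [ENNReal.inv_mul_cancel]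

lemma isingP_le (hn : 1 ≤ n) (J : Matrix (Fin n) (Fin n) ℝ) :
    isingP J ≤ sphP J + (n : ℝ)⁻¹ * (isingZ J / sphZ J - 1) := by
  have hlog := Real.log_le_sub_one_of_pos (div_pos (isingZ_pos J) (sphZ_pos hn J))
  rw [Real.log_div (isingZ_pos J).ne' (sphZ_pos hn J).ne'] at hlog
  rw [isingP, sphP, ← mul_add]
  gcongr
  linarith

end GibbsRatio


/-- If `J` is a random symmetric matrix whose law is orthogonally invariant, and `p(J)` and
`p^S(J)` are integrable, then `E[p(J)] ≤ E[p^S(J)]`. -/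
theorem stmt_0 {n : ℕ} (hn : 1 ≤ n)
    (μ : Measure (Matrix (Fin n) (Fin n) ℝ)) [IsProbabilityMeasure μ]
    (hsymm : μ {J | J.IsSymm} = 1)
    (hinv : ∀ Q : Matrix (Fin n) (Fin n) ℝ, Qᵀ * Q = 1 →
      Measure.map (fun J => Q * J * Qᵀ) μ = μ)
    (hint1 : Integrable (fun J => isingP J) μ)
    (hint2 : Integrable (fun J => sphP J) μ) :
    ∫ J, isingP J ∂μ ≤ ∫ J, sphP J ∂μ := by
  have hratio : (fun J : Matrix (Fin n) (Fin n) ℝ => isingZ J / sphZ J) =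
      fun J => (ENNReal.ofReal (isingZ J / sphZ J)).toReal :=
    funext fun J => (ENNReal.toReal_ofReal (div_pos (isingZ_pos J) (sphZ_pos hn J)).le).symm
  have hlint := lintegral_isingZ_div_sphZ μ hn hinv
  have hmeas := measurable_ofReal_isingZ_div_sphZ hn
  have hratio_integrable : Integrable (fun J => isingZ J / sphZ J) μ := by
    rw [hratio]
    exact integrable_toReal_of_lintegral_ne_top hmeas.aemeasurable (by simp [hlint])
  have hone : ∫ J, isingZ J / sphZ J ∂μ = 1 := by
    rw [hratio, integral_toReal hmeas.aemeasurable (by simp), hlint, ENNReal.toReal_one]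
  have hsub_integrable : Integrable (fun J => (n : ℝ)⁻¹ * (isingZ J / sphZ J - 1)) μ :=
    (hratio_integrable.sub (integrable_const 1)).const_mul _
  calc ∫ J, isingP J ∂μ
      ≤ ∫ J, (sphP J + (n : ℝ)⁻¹ * (isingZ J / sphZ J - 1)) ∂μ :=
        integral_mono hint1 (hint2.add hsub_integrable) fun J => isingP_le hn J
    _ = ∫ J, sphP J ∂μ := by
      rw [integral_add hint2 hsub_integrable, integral_const_mul,
        integral_sub hratio_integrable (integrable_const 1), hone]
      simp
end

section
/- Let n ≥ 1, let J ∈ ℝ^{n×n} be symmetric with largest eigenvalue λ_max(J), let s > λ_max(J)/2 (so that 2sI_n − J is positive definite), let ε ∈ (0,1), and let A := {x ∈ ℝⁿ : (1−ε)n ≤ ‖x‖² ≤ n}. Then (2π)^{n/2} · det(2sI_n − J)^{−1/2} ≥ vol(A) · exp(−sn) · Ẑ^S(J), where vol denotes n-dimensional Lebesgue measure. -/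
open MeasureTheory Matrix Real Filter

open scoped RealInnerProductSpace

theorem integral_radial_mul_angular {E : Type*} [NormedAddCommGroup E] [NormedSpace ℝ E]
    [MeasurableSpace E] [BorelSpace E] [Nontrivial E] [FiniteDimensional ℝ E]
    (μ : Measure E) [μ.IsAddHaarMeasure] (f : ℝ → ℝ) (h : E → ℝ) :
    ∫ x, f ‖x‖ * h (‖x‖⁻¹ • x) ∂μ =
      (∫ θ : Metric.sphere (0 : E) 1, h θ ∂μ.toSphere) *
        ∫ r : Set.Ioi (0 : ℝ), f r ∂Measure.volumeIoiPow (Module.finrank ℝ E - 1) := by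
  calc
    ∫ x, f ‖x‖ * h (‖x‖⁻¹ • x) ∂μ
        = ∫ x : ({(0)}ᶜ : Set E), f ‖x.1‖ * h (‖x.1‖⁻¹ • x.1) ∂(μ.comap (↑)) := by
      rw [integral_subtype_comap (measurableSet_singleton _).compl
        fun x ↦ f ‖x‖ * h (‖x‖⁻¹ • x), restrict_compl_singleton]
    _ = ∫ p, h p.1 * f p.2
          ∂μ.toSphere.prod (Measure.volumeIoiPow (Module.finrank ℝ E - 1)) := by
      simpa [mul_comm] using μ.measurePreserving_homeomorphUnitSphereProd.integral_comp
        (Homeomorph.measurableEmbedding _)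
        (fun p : Metric.sphere (0 : E) 1 × Set.Ioi (0 : ℝ) ↦ h p.1 * f p.2)
    _ = _ := integral_prod_mul (fun θ : Metric.sphere (0 : E) 1 ↦ h θ)
      (fun r : Set.Ioi (0 : ℝ) ↦ f r)

theorem toSphere_real_univ_mul_integral_radial_mul_angular {E : Type*} [NormedAddCommGroup E]
    [NormedSpace ℝ E] [MeasurableSpace E] [BorelSpace E] [Nontrivial E] [FiniteDimensional ℝ E]
    (μ : Measure E) [μ.IsAddHaarMeasure] (f : ℝ → ℝ) (h : E → ℝ) :
    μ.toSphere.real Set.univ * ∫ x, f ‖x‖ * h (‖x‖⁻¹ • x) ∂μ =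
      (∫ x, f ‖x‖ ∂μ) * ∫ θ : Metric.sphere (0 : E) 1, h θ ∂μ.toSphere := by
  have h₁ := integral_radial_mul_angular μ f fun _ ↦ 1
  simp only [mul_one, integral_const, smul_eq_mul] at h₁
  rw [integral_radial_mul_angular, h₁]
  ring

theorem qf_eq_sum_eigenvalues {n : ℕ} {J : Matrix (Fin n) (Fin n) ℝ} (hJ : J.IsHermitian)
    (x : EuclideanSpace ℝ (Fin n)) :
    qf J (fun i ↦ x i) = ∑ i, hJ.eigenvalues i * hJ.eigenvectorBasis.repr x i ^ 2 := by
  have hqf : qf J (fun i ↦ x i) = ⟪x, Matrix.toEuclideanLin J x⟫ := by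
    simp only [qf, PiLp.inner_apply, RCLike.inner_apply, conj_trivial, Matrix.ofLp_toLpLin,
      Matrix.toLin'_apply, Matrix.mulVec, dotProduct, Finset.sum_mul]
    refine Finset.sum_congr rfl fun i _ ↦ Finset.sum_congr rfl fun j _ ↦ ?_
    ring
  rw [hqf, ← hJ.eigenvectorBasis.sum_inner_mul_inner]
  refine Finset.sum_congr rfl fun i _ ↦ ?_
  have hb : Matrix.toEuclideanLin J (hJ.eigenvectorBasis i) =
      hJ.eigenvalues i • hJ.eigenvectorBasis i := by
    ext j
    simpa using congrFun (hJ.mulVec_eigenvectorBasis i) j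
  rw [← (Matrix.isSymmetric_toEuclideanLin_iff.mpr hJ) (hJ.eigenvectorBasis i) x, hb,
    inner_smul_left, OrthonormalBasis.repr_apply_apply, real_inner_comm x]
  simp
  ring

theorem qf_smul {n : ℕ} (J : Matrix (Fin n) (Fin n) ℝ) (c : ℝ) (x : Fin n → ℝ) :
    qf J (c • x) = c ^ 2 * qf J x := by
  simp only [qf, Finset.mul_sum, Pi.smul_apply, smul_eq_mul]
  refine Finset.sum_congr rfl fun i _ ↦ Finset.sum_congr rfl fun j _ ↦ ?_
  ring

theorem qf_half_sub_eq_sum {n : ℕ} {J : Matrix (Fin n) (Fin n) ℝ} (hJ : J.IsHermitian) (s : ℝ)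
    (x : EuclideanSpace ℝ (Fin n)) :
    (1 / 2) * qf J (fun i ↦ x i) - s * ‖x‖ ^ 2 =
      ∑ i, -(s - hJ.eigenvalues i / 2) * hJ.eigenvectorBasis.repr x i ^ 2 := by
  rw [qf_eq_sum_eigenvalues hJ, ← hJ.eigenvectorBasis.repr.norm_map x,
    EuclideanSpace.real_norm_sq_eq, Finset.mul_sum, Finset.mul_sum, ← Finset.sum_sub_distrib]
  refine Finset.sum_congr rfl fun i _ ↦ ?_
  ring

theorem det_smul_one_sub_eq_prod {n : ℕ} {J : Matrix (Fin n) (Fin n) ℝ} (hJ : J.IsHermitian)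
    (t : ℝ) :
    (t • (1 : Matrix (Fin n) (Fin n) ℝ) - J).det = ∏ i, (t - hJ.eigenvalues i) := by
  have h := congrArg (Polynomial.eval t) hJ.charpoly_eq
  rw [Matrix.eval_charpoly, Polynomial.eval_prod] at h
  simpa [Matrix.smul_one_eq_diagonal] using h

section Gaussian

variable {ι : Type*} [Fintype ι] {b : ι → ℝ}

theorem integrable_exp_sum_neg_mul_sq (hb : ∀ i, 0 < b i) :
    Integrable fun y : EuclideanSpace ℝ ι ↦ rexp (∑ i, -b i * y i ^ 2) := by
  rw [← (PiLp.volume_preserving_toLp ι).integrable_comp_emb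
    (MeasurableEquiv.toLp 2 _).measurableEmbedding]
  simp only [Function.comp_def, Real.exp_sum]
  exact Integrable.fintype_prod (f := fun i (v : ℝ) ↦ rexp (-b i * v ^ 2))
    fun i ↦ integrable_exp_neg_mul_sq (hb i)

theorem integral_exp_sum_neg_mul_sq (b : ι → ℝ) :
    ∫ y : EuclideanSpace ℝ ι, rexp (∑ i, -b i * y i ^ 2) = ∏ i, √(π / b i) := by
  rw [← (PiLp.volume_preserving_toLp ι).integral_comp
    (MeasurableEquiv.toLp 2 _).measurableEmbedding]
  simp only [Real.exp_sum]
  rw [integral_fintype_prod_volume_eq_prod (fun i (v : ℝ) ↦ rexp (-b i * v ^ 2))]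
  simp only [integral_gaussian]

end Gaussian

theorem integrable_exp_half_qf_sub {n : ℕ} {J : Matrix (Fin n) (Fin n) ℝ} (hJ : J.IsHermitian)
    {s : ℝ} (hs : ∀ i, hJ.eigenvalues i / 2 < s) :
    Integrable fun x : EuclideanSpace ℝ (Fin n) ↦
      rexp ((1 / 2) * qf J (fun i ↦ x i) - s * ‖x‖ ^ 2) := by
  simp only [qf_half_sub_eq_sum hJ]
  exact (hJ.eigenvectorBasis.measurePreserving_repr.integrable_comp_emb
    hJ.eigenvectorBasis.repr.toHomeomorph.measurableEmbedding).mpr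
    (integrable_exp_sum_neg_mul_sq fun i ↦ sub_pos.mpr (hs i))

theorem integral_exp_half_qf_sub {n : ℕ} {J : Matrix (Fin n) (Fin n) ℝ} (hJ : J.IsHermitian)
    {s : ℝ} (hs : ∀ i, hJ.eigenvalues i / 2 < s) :
    ∫ x : EuclideanSpace ℝ (Fin n), rexp ((1 / 2) * qf J (fun i ↦ x i) - s * ‖x‖ ^ 2) =
      (2 * π) ^ ((n : ℝ) / 2) *
        ((2 * s) • (1 : Matrix (Fin n) (Fin n) ℝ) - J).det ^ (-(1 : ℝ) / 2) := by
  have hpos : ∀ i, 0 < 2 * s - hJ.eigenvalues i := fun i ↦ by linarith [hs i]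
  simp only [qf_half_sub_eq_sum hJ]
  rw [hJ.eigenvectorBasis.measurePreserving_repr.integral_comp
    hJ.eigenvectorBasis.repr.toHomeomorph.measurableEmbedding
    (fun y ↦ rexp (∑ i, -(s - hJ.eigenvalues i / 2) * y i ^ 2)),
    integral_exp_sum_neg_mul_sq, det_smul_one_sub_eq_prod hJ,
    ← Real.finsetProd_rpow _ _ fun i _ ↦ (hpos i).le]
  have hpi : (2 * π) ^ ((n : ℝ) / 2) = ∏ _i : Fin n, (2 * π) ^ (1 / 2 : ℝ) := by
    rw [Finset.prod_const, Finset.card_univ, Fintype.card_fin, ← Real.rpow_natCast,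
      ← Real.rpow_mul (by positivity)]
    ring_nf
  rw [hpi, ← Finset.prod_mul_distrib]
  refine Finset.prod_congr rfl fun i _ ↦ ?_
  have hdiv : π / (s - hJ.eigenvalues i / 2) = 2 * π / (2 * s - hJ.eigenvalues i) := by
    rw [div_eq_div_iff (by linarith [hs i]) (hpos i).ne']
    ring
  rw [hdiv, Real.sqrt_eq_rpow, Real.div_rpow (by positivity) (hpos i).le, neg_div,
    Real.rpow_neg (hpos i).le, div_eq_mul_inv]

theorem sphZ_eq {n : ℕ} (J : Matrix (Fin n) (Fin n) ℝ) :
    sphZ J = ((volume : Measure (EuclideanSpace ℝ (Fin n))).toSphere.real Set.univ)⁻¹ *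
      ∫ θ : Metric.sphere (0 : EuclideanSpace ℝ (Fin n)) 1,
        rexp ((1 / 2) * qf J (fun i ↦ (√n • (θ : EuclideanSpace ℝ (Fin n))) i))
        ∂(volume : Measure (EuclideanSpace ℝ (Fin n))).toSphere := by
  have hcont : Continuous fun x : EuclideanSpace ℝ (Fin n) ↦
      rexp ((1 / 2) * qf J (fun i ↦ x i)) := by
    unfold qf
    fun_prop
  rw [sphZ, unifSphere, integral_map (by fun_prop) hcont.aestronglyMeasurable,
    integral_smul_measure, ENNReal.toReal_inv, smul_eq_mul, measureReal_def]

theorem half_qf_sub_le_of_norm_sq_le {n : ℕ} {J : Matrix (Fin n) (Fin n) ℝ} (hJ : J.IsHermitian)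
    {s : ℝ} (hs : ∀ i, hJ.eigenvalues i / 2 < s) {x : EuclideanSpace ℝ (Fin n)} (hx : x ≠ 0)
    (hxn : ‖x‖ ^ 2 ≤ n) :
    (1 / 2) * qf J (fun i ↦ (√n • ‖x‖⁻¹ • x) i) - s * n ≤
      (1 / 2) * qf J (fun i ↦ x i) - s * ‖x‖ ^ 2 := by
  have hx₀ : 0 < ‖x‖ := norm_pos_iff.mpr hx
  have hq : qf J (fun i ↦ (√n • ‖x‖⁻¹ • x) i) = n / ‖x‖ ^ 2 * qf J (fun i ↦ x i) := by
    rw [smul_smul]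
    refine (qf_smul J (√n * ‖x‖⁻¹) fun i ↦ x i).trans ?_
    rw [mul_pow, Real.sq_sqrt n.cast_nonneg, inv_pow, div_eq_mul_inv]
  have hle : (1 / 2) * qf J (fun i ↦ x i) - s * ‖x‖ ^ 2 ≤ 0 := by
    rw [qf_half_sub_eq_sum hJ]
    refine Finset.sum_nonpos fun i _ ↦ mul_nonpos_of_nonpos_of_nonneg ?_ (sq_nonneg _)
    linarith [hs i]
  have hone : 1 ≤ (n : ℝ) / ‖x‖ ^ 2 := (one_le_div₀ (by positivity)).mpr hxn
  calc
    _ = n / ‖x‖ ^ 2 * ((1 / 2) * qf J (fun i ↦ x i) - s * ‖x‖ ^ 2) := by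
      rw [hq]
      field_simp
    _ ≤ _ := by nlinarith

/-- Gaussian-integral bound: for symmetric `J`, `s > λ_max(J)/2`, `ε ∈ (0,1)` and the shell
`A = {x : (1-ε)n ≤ ‖x‖² ≤ n}`, one has
`(2π)^{n/2} det(2sI - J)^{-1/2} ≥ vol(A) · exp(-sn) · Ẑ^S(J)`. -/
theorem stmt_3 {n : ℕ} (hn : 1 ≤ n) (J : Matrix (Fin n) (Fin n) ℝ) (hJ : J.IsHermitian)
    (s : ℝ) (hs : ∀ i, hJ.eigenvalues i / 2 < s)
    (ε : ℝ) (hε : ε ∈ Set.Ioo (0 : ℝ) 1) :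
    (volume {x : EuclideanSpace ℝ (Fin n) |
        (1 - ε) * n ≤ ‖x‖ ^ 2 ∧ ‖x‖ ^ 2 ≤ n}).toReal * Real.exp (-(s * n)) * sphZ J ≤
      (2 * Real.pi) ^ ((n : ℝ) / 2) *
        ((2 * s) • (1 : Matrix (Fin n) (Fin n) ℝ) - J).det ^ (-(1 : ℝ) / 2) := by
  have : Nonempty (Fin n) := ⟨⟨0, hn⟩⟩
  set E := EuclideanSpace ℝ (Fin n)
  set B : Set ℝ := {r | (1 - ε) * n ≤ r ^ 2 ∧ r ^ 2 ≤ n}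
  set f : ℝ → ℝ := B.indicator 1 with hf
  set h : E → ℝ := fun x ↦ rexp ((1 / 2) * qf J (fun i ↦ (√n • x) i)) with hh
  have hB : MeasurableSet B :=
    (measurableSet_le (f := fun _ : ℝ ↦ (1 - ε) * n) (g := fun r ↦ r ^ 2)
      (by fun_prop) (by fun_prop)).inter
      (measurableSet_le (f := fun r : ℝ ↦ r ^ 2) (g := fun _ ↦ (n : ℝ))
        (by fun_prop) (by fun_prop))
  have hvol : (volume {x : E | (1 - ε) * n ≤ ‖x‖ ^ 2 ∧ ‖x‖ ^ 2 ≤ n}).toReal =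
      ∫ x : E, f ‖x‖ := by
    rw [← measureReal_def]
    exact (integral_indicator_one (μ := (volume : Measure E)) (measurable_norm hB)).symm
  have hσ : (volume : Measure E).toSphere.real Set.univ ≠ 0 := by
    rw [measureReal_def]
    exact ENNReal.toReal_ne_zero.mpr
      ⟨Measure.measure_univ_ne_zero.mpr (Measure.toSphere_ne_zero _), measure_ne_top _ _⟩
  have hpolar := toSphere_real_univ_mul_integral_radial_mul_angular (volume : Measure E) f h
  have hlhs : (∫ x : E, f ‖x‖) * rexp (-(s * n)) * sphZ J =
      ∫ x : E, rexp (-(s * n)) * (f ‖x‖ * h (‖x‖⁻¹ • x)) := by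
    rw [integral_const_mul, sphZ_eq, mul_right_comm, mul_left_comm, ← hpolar,
      inv_mul_cancel_left₀ hσ, mul_comm]
  rw [hvol, hlhs, ← integral_exp_half_qf_sub hJ hs]
  refine integral_mono_of_nonneg (.of_forall fun x ↦ ?_) (integrable_exp_half_qf_sub hJ hs)
    (.of_forall fun x ↦ ?_)
  · have : 0 ≤ f ‖x‖ := Set.indicator_nonneg (fun _ _ ↦ zero_le_one) _
    positivity
  · by_cases hx : ‖x‖ ∈ B
    · have hx₀ : x ≠ 0 := by
        rintro rfl
        have : 0 < (1 - ε) * n := mul_pos (sub_pos.mpr hε.2) (by exact_mod_cast hn)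
        have := hx.1
        simp at this
        linarith
      simp only [hf, Set.indicator_of_mem hx, Pi.one_apply, one_mul, hh, ← Real.exp_add]
      rw [Real.exp_le_exp, neg_add_eq_sub]
      exact half_qf_sub_le_of_norm_sq_le hJ hs hx₀ hx.2
    · simp only [hf, Set.indicator_of_notMem hx, zero_mul, mul_zero]
      positivity
end

section
/- Let n ≥ 1, let P ∈ ℝ^{n×n} be an orthogonal projection matrix (P = Pᵀ = P²), let x ∈ {−1,1}ⁿ, and let ε ∈ [0,1] be such that ‖Px‖² ≥ (1−ε²)n. Then for every y ∈ ℝⁿ with ‖y‖² = n, one has ‖Py‖² ≥ ⟨x,y⟩²/n − 2εn. -/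
open Matrix Real

/-- An orthogonal projection may be moved freely between the two sides of the dot product. -/
lemma dotProduct_mulVec_of_isProj {n : ℕ} {P : Matrix (Fin n) (Fin n) ℝ}
    (hPsymm : Pᵀ = P) (hPproj : P * P = P) (a b : Fin n → ℝ) :
    P *ᵥ a ⬝ᵥ P *ᵥ b = a ⬝ᵥ P *ᵥ b := by
  conv_lhs => rw [← hPsymm]
  rw [mulVec_transpose, ← dotProduct_mulVec, hPsymm, mulVec_mulVec, hPproj]

/-- Splitting of the dot product along an orthogonal projection and its complement. -/
lemma sum_mul_eq_add_of_isProj {n : ℕ} {P : Matrix (Fin n) (Fin n) ℝ}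
    (hPsymm : Pᵀ = P) (hPproj : P * P = P) (a b : Fin n → ℝ) :
    ∑ i, a i * b i = ∑ i, (P *ᵥ a) i * (P *ᵥ b) i +
      ∑ i, (a i - (P *ᵥ a) i) * (b i - (P *ᵥ b) i) := by
  have h₁ := dotProduct_mulVec_of_isProj hPsymm hPproj a b
  have h₂ := dotProduct_mulVec_of_isProj hPsymm hPproj b a
  simp only [dotProduct] at h₁ h₂
  simp only [sub_mul, mul_sub, Finset.sum_sub_distrib]
  simp only [mul_comm (P.mulVec b _), mul_comm (b _)] at h₂
  linarith

/-- Numerical inequality behind the projection bound: `A`, `B` and `C`, `D` are the squared norms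
of the components of two vectors of squared norm `N`, and `u`, `v` the inner products of these
components. -/
lemma add_sq_le_of_sq_le_mul {N A B C D u v ε : ℝ}
    (hA : 0 ≤ A) (hB : 0 ≤ B) (hC : 0 ≤ C) (hD : 0 ≤ D)
    (hAB : A + B = N) (hCD : C + D = N) (hu : u ^ 2 ≤ C * A) (hv : v ^ 2 ≤ D * B)
    (hε₀ : 0 ≤ ε) (hε₁ : ε ≤ 1) (hDε : D ≤ ε ^ 2 * N) :
    (u + v) ^ 2 ≤ N * A + 2 * ε * N ^ 2 := by
  have hN : 0 ≤ N := by linarith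
  have hu' : u ^ 2 ≤ N * A := hu.trans (by gcongr; linarith)
  have hCD' : C * D ≤ N * (ε ^ 2 * N) := by gcongr; linarith
  have hAB' : A * B ≤ N ^ 2 / 4 := by subst hAB; nlinarith [sq_nonneg (A - B)]
  have huv : 2 * (u * v) ≤ ε * N ^ 2 := by
    refine (abs_le_of_sq_le_sq' ?_ (by positivity)).2
    calc (2 * (u * v)) ^ 2 = 4 * (u ^ 2 * v ^ 2) := by ring
      _ ≤ 4 * ((C * A) * (D * B)) := by gcongr
      _ = 4 * ((C * D) * (A * B)) := by ring
      _ ≤ 4 * ((N * (ε ^ 2 * N)) * (N ^ 2 / 4)) := by gcongr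
      _ = (ε * N ^ 2) ^ 2 := by ring
  have hv' : v ^ 2 ≤ ε * N ^ 2 := by
    calc v ^ 2 ≤ D * B := hv
      _ ≤ (ε ^ 2 * N) * N := by gcongr; linarith
      _ = ε ^ 2 * N ^ 2 := by ring
      _ ≤ ε * N ^ 2 := by gcongr; nlinarith
  linarith [add_sq u v]

/-- If `P` is an orthogonal projection, `x ∈ {-1,1}ⁿ` with `‖Px‖² ≥ (1-ε²)n`, then for every
`y` with `‖y‖² = n` we have `‖Py‖² ≥ ⟨x,y⟩²/n - 2εn`. -/
theorem stmt_7 {n : ℕ} (hn : 1 ≤ n) (P : Matrix (Fin n) (Fin n) ℝ)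
    (hPsymm : Pᵀ = P) (hPproj : P * P = P)
    (x : Fin n → ℝ) (hx : ∀ i, x i = 1 ∨ x i = -1)
    (ε : ℝ) (hε : ε ∈ Set.Icc (0 : ℝ) 1)
    (hPx : (1 - ε ^ 2) * n ≤ ∑ i, (P.mulVec x i) ^ 2)
    (y : Fin n → ℝ) (hy : ∑ i, (y i) ^ 2 = n) :
    (∑ i, x i * y i) ^ 2 / n - 2 * ε * n ≤ ∑ i, (P.mulVec y i) ^ 2 := by
  have hn' : (0 : ℝ) < n := by exact_mod_cast hn
  have hxn : ∑ i, (x i) ^ 2 = n := by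
    have h : ∀ i, x i ^ 2 = 1 := fun i => by rcases hx i with h | h <;> simp [h]
    simp [h]
  have hxx := sum_mul_eq_add_of_isProj hPsymm hPproj x x
  have hyy := sum_mul_eq_add_of_isProj hPsymm hPproj y y
  simp only [← sq] at hxx hyy
  have key := add_sq_le_of_sq_le_mul (by positivity) (by positivity) (by positivity)
    (by positivity) (hyy.symm.trans hy) (hxx.symm.trans hxn)
    (Finset.sum_mul_sq_le_sq_mul_sq Finset.univ (P *ᵥ x) (P *ᵥ y))
    (Finset.sum_mul_sq_le_sq_mul_sq Finset.univ (fun i => x i - (P *ᵥ x) i)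
      (fun i => y i - (P *ᵥ y) i)) hε.1 hε.2 (by linarith)
  rw [← sum_mul_eq_add_of_isProj hPsymm hPproj x y] at key
  rw [sub_le_iff_le_add, div_le_iff₀ hn']
  linarith
end

section
/- Let n ≥ 1, η > 0, let P ∈ ℝ^{n×n} be an orthogonal projection matrix (P = Pᵀ = P²), let x ∈ {−1,1}ⁿ, and let ε ∈ [0,1] be such that ‖Px‖² ≥ (1−ε²)n. Then p(ηP) ≥ −log 2 − εη + (1/n) log( Σ_{r=0}^{n} binom(n,r) · exp( (η/(2n)) (2r − n)² ) ). -/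
open MeasureTheory Matrix Real Filter

lemma qf_smul_eq {n : ℕ} (η : ℝ) (P : Matrix (Fin n) (Fin n) ℝ) (y : Fin n → ℝ) :
    qf (η • P) y = η * (y ⬝ᵥ P *ᵥ y) := by
  simp only [qf, dotProduct, mulVec, Finset.mul_sum, Matrix.smul_apply, smul_eq_mul]
  exact Finset.sum_congr rfl fun i _ => Finset.sum_congr rfl fun j _ => by ring

lemma mulVec_dotProduct_mulVec_of_proj {n : ℕ} {P : Matrix (Fin n) (Fin n) ℝ} (hPsymm : Pᵀ = P)
    (hPproj : P * P = P) (y z : Fin n → ℝ) : (P *ᵥ y) ⬝ᵥ (P *ᵥ z) = y ⬝ᵥ P *ᵥ z := by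
  rw [dotProduct_mulVec, ← mulVec_transpose, hPsymm, mulVec_mulVec, hPproj, dotProduct_mulVec,
    ← mulVec_transpose, hPsymm]

lemma dotProduct_sq_le {n : ℕ} (u v : Fin n → ℝ) : (u ⬝ᵥ v) ^ 2 ≤ (u ⬝ᵥ u) * (v ⬝ᵥ v) := by
  have h := Finset.sum_mul_sq_le_sq_mul_sq Finset.univ u v
  simpa only [dotProduct, pow_two] using h

/-- If a projection nearly fixes `x`, its quadratic form nearly dominates that of `x xᵀ / n`. -/
lemma dotProduct_sq_le_of_proj {n : ℕ} {P : Matrix (Fin n) (Fin n) ℝ} (hPsymm : Pᵀ = P)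
    (hPproj : P * P = P) {x y : Fin n → ℝ} (hx : x ⬝ᵥ x = n) (hy : y ⬝ᵥ y = n)
    {ε : ℝ} (hε : ε ∈ Set.Icc (0 : ℝ) 1) (hPx : (1 - ε ^ 2) * n ≤ x ⬝ᵥ P *ᵥ x) :
    (x ⬝ᵥ y) ^ 2 ≤ n * (y ⬝ᵥ P *ᵥ y) + 2 * ε * n ^ 2 := by
  obtain ⟨h0, h1⟩ := hε
  have hyx : y ⬝ᵥ P *ᵥ x = x ⬝ᵥ P *ᵥ y := by
    rw [dotProduct_mulVec, ← mulVec_transpose, hPsymm, dotProduct_comm]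
  have hP := mulVec_dotProduct_mulVec_of_proj hPsymm hPproj
  have hα := dotProduct_sq_le x (P *ᵥ y)
  have hβ := dotProduct_sq_le (x - P *ᵥ x) (y - P *ᵥ y)
  have hp : 0 ≤ (P *ᵥ y) ⬝ᵥ (P *ᵥ y) :=
    Finset.sum_nonneg fun _ _ => mul_self_nonneg _
  have hq : 0 ≤ (y - P *ᵥ y) ⬝ᵥ (y - P *ᵥ y) :=
    Finset.sum_nonneg fun _ _ => mul_self_nonneg _
  simp only [sub_dotProduct, dotProduct_sub, hP, dotProduct_comm (P *ᵥ _) x,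
    dotProduct_comm (P *ᵥ _) y, hyx, hx, hy] at hα hβ hp hq
  have hn : (0 : ℝ) ≤ n := Nat.cast_nonneg n
  generalize x ⬝ᵥ P *ᵥ y = a at *
  generalize y ⬝ᵥ P *ᵥ y = p at *
  generalize x ⬝ᵥ P *ᵥ x = c at *
  generalize x ⬝ᵥ y = t at *
  generalize (n : ℝ) = m at *
  obtain ⟨b, rfl⟩ : ∃ b, t = a + b := ⟨t - a, by ring⟩
  obtain ⟨q, rfl⟩ : ∃ q, m = p + q := ⟨m - p, by ring⟩
  have hq' : 0 ≤ q := by linarith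
  have hb : b ^ 2 ≤ ε ^ 2 * (p + q) * q := by
    calc b ^ 2 ≤ (p + q - c) * q := by nlinarith
      _ ≤ ε ^ 2 * (p + q) * q := by gcongr; linarith
  have hab : 2 * a * b ≤ ε * (p + q) ^ 2 := by
    refine (abs_le_of_sq_le_sq' ?_ (by positivity)).2
    calc (2 * a * b) ^ 2 = 4 * (a ^ 2 * b ^ 2) := by ring
      _ ≤ 4 * (((p + q) * p) * (ε ^ 2 * (p + q) * q)) := by gcongr
      _ = ε ^ 2 * (p + q) ^ 2 * (4 * p * q) := by ring
      _ ≤ ε ^ 2 * (p + q) ^ 2 * (p + q) ^ 2 := by gcongr; nlinarith [sq_nonneg (p - q)]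
      _ = (ε * (p + q) ^ 2) ^ 2 := by ring
  have hb' : b ^ 2 ≤ ε * (p + q) ^ 2 := by
    calc b ^ 2 ≤ ε ^ 2 * (p + q) * q := hb
      _ ≤ ε * (p + q) * (p + q) := by gcongr <;> nlinarith
      _ = ε * (p + q) ^ 2 := by ring
  nlinarith

lemma dotProduct_self_of_sign {n : ℕ} {x : Fin n → ℝ} (hx : ∀ i, x i = 1 ∨ x i = -1) :
    x ⬝ᵥ x = n := by
  have h : ∀ i, x i * x i = 1 := fun i => by rcases hx i with h | h <;> simp [h]
  simp [dotProduct, h]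

lemma sgn_eq_one_or {n : ℕ} (b : Fin n → Bool) (i : Fin n) : sgn b i = 1 ∨ sgn b i = -1 := by
  cases h : b i <;> simp [sgn, h]

/-- Overlaps with a fixed sign vector are distributed binomially. -/
lemma sum_dotProduct_sgn {n : ℕ} {x : Fin n → ℝ} (hx : ∀ i, x i = 1 ∨ x i = -1) (f : ℝ → ℝ) :
    ∑ b : Fin n → Bool, f (x ⬝ᵥ sgn b) =
      ∑ r ∈ Finset.range (n + 1), (n.choose r : ℝ) * f (2 * (r : ℝ) - n) := by
  classical
  have hcard := Finset.sum_powerset_apply_card (x := (Finset.univ : Finset (Fin n)))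
    fun r : ℕ => f (2 * (r : ℝ) - n)
  simp only [Finset.card_univ, Fintype.card_fin, nsmul_eq_mul] at hcard
  rw [← hcard]
  refine Finset.sum_bij' (fun b _ => Finset.univ.filter fun i => x i = sgn b i)
    (fun s _ i => decide (i ∈ s ↔ x i = 1)) (by simp) (by simp) ?_ ?_ ?_
  · intro b _
    ext i
    simp only [Finset.mem_filter_univ]
    rcases hx i with h | h <;> cases hb : b i <;> norm_num [sgn, h, hb]
  · intro s _
    ext i
    rcases hx i with h | h <;> by_cases hs : i ∈ s <;> norm_num [sgn, h, hs]
  · intro b _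
    congr 1
    have hterm : ∀ i, x i * sgn b i = 2 * (if x i = sgn b i then 1 else 0) - 1 := fun i => by
      rcases hx i with h | h <;> rcases sgn_eq_one_or b i with h' | h' <;> norm_num [h, h']
    simp only [dotProduct, hterm, Finset.sum_sub_distrib, ← Finset.mul_sum, Finset.sum_boole]
    simp

/-- If `P` is an orthogonal projection and `x ∈ {-1,1}ⁿ` with `‖Px‖² ≥ (1-ε²)n`, then
`p(ηP) ≥ -log 2 - εη + (1/n) log( ∑_{r=0}^n C(n,r) exp((η/(2n))(2r-n)²) )`. -/
theorem stmt_8 {n : ℕ} (hn : 1 ≤ n) (η : ℝ) (hη : 0 < η)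
    (P : Matrix (Fin n) (Fin n) ℝ) (hPsymm : Pᵀ = P) (hPproj : P * P = P)
    (x : Fin n → ℝ) (hx : ∀ i, x i = 1 ∨ x i = -1)
    (ε : ℝ) (hε : ε ∈ Set.Icc (0 : ℝ) 1)
    (hPx : (1 - ε ^ 2) * n ≤ ∑ i, (P.mulVec x i) ^ 2) :
    -Real.log 2 - ε * η +
        (n : ℝ)⁻¹ * Real.log (∑ r ∈ Finset.range (n + 1),
          (n.choose r : ℝ) * Real.exp (η / (2 * n) * (2 * (r : ℝ) - n) ^ 2)) ≤
      isingP (η • P) := by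
  have hn0 : (0 : ℝ) < n := by exact_mod_cast hn
  have hPx' : (1 - ε ^ 2) * n ≤ x ⬝ᵥ P *ᵥ x := by
    rw [← mulVec_dotProduct_mulVec_of_proj hPsymm hPproj]
    simpa only [dotProduct, pow_two] using hPx
  rw [← sum_dotProduct_sgn hx fun t => Real.exp (η / (2 * n) * t ^ 2)]
  set S := ∑ b : Fin n → Bool, Real.exp (η / (2 * n) * (x ⬝ᵥ sgn b) ^ 2) with hS
  have hSpos : 0 < S := Finset.sum_pos (fun b _ => Real.exp_pos _) Finset.univ_nonempty
  have hZ : ((2 : ℝ) ^ n)⁻¹ * (Real.exp (-(n * (ε * η))) * S) ≤ isingZ (η • P) := by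
    rw [isingZ, hS, Finset.mul_sum]
    gcongr with b
    rw [← Real.exp_add, Real.exp_le_exp, qf_smul_eq]
    have h := dotProduct_sq_le_of_proj hPsymm hPproj (dotProduct_self_of_sign hx)
      (dotProduct_self_of_sign (sgn_eq_one_or b)) hε hPx'
    calc -(n * (ε * η)) + η / (2 * n) * (x ⬝ᵥ sgn b) ^ 2
        ≤ -(n * (ε * η)) + η / (2 * n) * (n * (sgn b ⬝ᵥ P *ᵥ sgn b) + 2 * ε * n ^ 2) := by gcongr
      _ = 1 / 2 * (η * (sgn b ⬝ᵥ P *ᵥ sgn b)) := by field_simp; ring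
  have hlog := Real.log_le_log (by positivity) hZ
  rw [Real.log_mul (by positivity) (by positivity), Real.log_mul (by positivity) (by positivity),
    Real.log_inv, Real.log_pow, Real.log_exp] at hlog
  calc _ = (n : ℝ)⁻¹ * (-(n * Real.log 2) + (-(n * (ε * η)) + Real.log S)) := by
        field_simp; ring
    _ ≤ isingP (η • P) := by rw [isingP]; gcongr
end

section
/- For every fixed η ≥ 0, lim_{n→∞} (1/n) log( Σ_{r=0}^{n} binom(n,r) · exp( (η/(2n)) (2r − n)² ) ) = sup_{x ∈ [0,1]} { H(x) + (η/2)(2x − 1)² }. -/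
open Real Filter

/-- The binary entropy function `H(x) = -x log x - (1-x) log (1-x)`
(with the convention `log 0 = 0`, so `H 0 = H 1 = 0`). -/
noncomputable def binH (x : ℝ) : ℝ := -x * Real.log x - (1 - x) * Real.log (1 - x)

lemma binH_eq_binEntropy : binH = binEntropy := by
  ext x
  simp only [binH, binEntropy, log_inv]
  ring

lemma continuous_binH_add (η : ℝ) :
    Continuous fun x : ℝ => binH x + η / 2 * (2 * x - 1) ^ 2 := by
  rw [binH_eq_binEntropy]
  fun_prop

lemma factorial_mul_pow_le (r k : ℕ) : r.factorial * r ^ k ≤ k.factorial * r ^ r := by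
  rcases le_total r k with h | h
  · calc r.factorial * r ^ k = r.factorial * r ^ (k - r) * r ^ r := by
          rw [mul_assoc, ← pow_add, Nat.sub_add_cancel h]
      _ ≤ k.factorial * r ^ r :=
          Nat.mul_le_mul_right _ (Nat.factorial_mul_pow_sub_le_factorial h)
  · calc r.factorial * r ^ k ≤ k.factorial * r ^ (r - k) * r ^ k := by
          refine Nat.mul_le_mul_right _ ?_
          rw [← Nat.factorial_mul_descFactorial (Nat.sub_le r k), Nat.sub_sub_self h]
          exact Nat.mul_le_mul_left _ (Nat.descFactorial_le_pow _ _)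
      _ = k.factorial * r ^ r := by
          rw [mul_assoc, ← pow_add, Nat.sub_add_cancel h]

lemma pow_mul_pow_mul_choose_le (r s k l : ℕ) (h : k + l = r + s) :
    r ^ k * s ^ l * (k + l).choose k ≤ r ^ r * s ^ s * (r + s).choose r := by
  have hk := Nat.add_choose_mul_factorial_mul_factorial k l
  rw [← Nat.choose_symm_add] at hk
  have hr := Nat.add_choose_mul_factorial_mul_factorial r s
  rw [← Nat.choose_symm_add] at hr
  have hpos : 0 < k.factorial * l.factorial * (r.factorial * s.factorial) := by positivity
  refine Nat.le_of_mul_le_mul_left ?_ hpos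
  calc k.factorial * l.factorial * (r.factorial * s.factorial) *
        (r ^ k * s ^ l * (k + l).choose k)
      = (r.factorial * r ^ k) * (s.factorial * s ^ l) * (r + s).factorial := by
        rw [← h, ← hk]; ring
    _ ≤ (k.factorial * r ^ r) * (l.factorial * s ^ s) * (r + s).factorial := by
        exact Nat.mul_le_mul_right _
          (Nat.mul_le_mul (factorial_mul_pow_le r k) (factorial_mul_pow_le s l))
    _ = _ := by rw [← hr]; ring

lemma pow_mul_pow_mul_choose_le_add_pow (r s : ℕ) :
    r ^ r * s ^ s * (r + s).choose r ≤ (r + s) ^ (r + s) := by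
  rw [add_pow]
  refine le_trans (le_of_eq ?_) (Finset.single_le_sum
    (f := fun m => r ^ m * s ^ (r + s - m) * (r + s).choose m)
    (fun _ _ => Nat.zero_le _) (Finset.mem_range.2 (show r < r + s + 1 by omega)))
  simp

lemma add_pow_le_mul_pow_mul_pow_mul_choose (r s : ℕ) :
    (r + s) ^ (r + s) ≤ (r + s + 1) * (r ^ r * s ^ s * (r + s).choose r) := by
  rw [add_pow]
  refine (Finset.sum_le_card_nsmul _ _ (r ^ r * s ^ s * (r + s).choose r) ?_).trans ?_
  · intro m hm
    have hm' : m + (r + s - m) = r + s := by have := Finset.mem_range.1 hm; omega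
    simpa only [hm', Nat.cast_id] using pow_mul_pow_mul_choose_le r s m (r + s - m) hm'
  · simp

lemma exp_natCast_mul_log (r : ℕ) : exp (r * log r) = (r : ℝ) ^ r := by
  rcases Nat.eq_zero_or_pos r with rfl | h
  · simp
  · rw [exp_nat_mul, exp_log (by exact_mod_cast h)]

lemma natCast_mul_binH_div {r s : ℕ} (h : 0 < r + s) :
    ((r + s : ℕ) : ℝ) * binH (r / (r + s : ℕ)) =
      (r + s : ℕ) * log (r + s : ℕ) - r * log r - s * log s := by
  have hn : ((r + s : ℕ) : ℝ) ≠ 0 := by positivity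
  have h1 : 1 - (r : ℝ) / (r + s : ℕ) = s / (r + s : ℕ) := by
    field_simp
    push_cast
    ring
  have key (t : ℕ) : (t : ℝ) * log (t / (r + s : ℕ)) = t * log t - t * log (r + s : ℕ) := by
    rcases Nat.eq_zero_or_pos t with rfl | ht
    · simp
    · rw [log_div (by positivity) hn]
      ring
  have hsplit : ((r + s : ℕ) : ℝ) * binH (r / (r + s : ℕ)) =
      -(r * log (r / (r + s : ℕ))) - s * log (s / (r + s : ℕ)) := by
    rw [binH, h1]
    field_simp
  rw [hsplit, key, key]
  push_cast
  ring

lemma exp_mul_binH_mul_pow_mul_pow {r s : ℕ} (h : 0 < r + s) :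
    exp ((r + s : ℕ) * binH (r / (r + s : ℕ))) * ((r : ℝ) ^ r * (s : ℝ) ^ s) =
      ((r + s : ℕ) : ℝ) ^ (r + s) := by
  rw [natCast_mul_binH_div h, ← exp_natCast_mul_log r, ← exp_natCast_mul_log s,
    ← exp_natCast_mul_log (r + s), ← exp_add, ← exp_add]
  ring_nf

lemma pow_self_mul_pow_self_pos (r s : ℕ) : 0 < (r : ℝ) ^ r * (s : ℝ) ^ s := by
  rw [← exp_natCast_mul_log r, ← exp_natCast_mul_log s]
  positivity

lemma choose_le_exp_mul_binH {n r : ℕ} (hn : 0 < n) (hr : r ≤ n) :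
    (n.choose r : ℝ) ≤ exp (n * binH (r / n)) := by
  obtain ⟨s, rfl⟩ := Nat.exists_eq_add_of_le hr
  refine le_of_mul_le_mul_right ?_ (pow_self_mul_pow_self_pos r s)
  rw [exp_mul_binH_mul_pow_mul_pow hn, mul_comm]
  exact_mod_cast pow_mul_pow_mul_choose_le_add_pow r s

lemma exp_mul_binH_le_mul_choose {n r : ℕ} (hn : 0 < n) (hr : r ≤ n) :
    exp (n * binH (r / n)) ≤ (n + 1) * n.choose r := by
  obtain ⟨s, rfl⟩ := Nat.exists_eq_add_of_le hr
  refine le_of_mul_le_mul_right ?_ (pow_self_mul_pow_self_pos r s)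
  rw [exp_mul_binH_mul_pow_mul_pow hn, mul_assoc, mul_comm ((r + s).choose r : ℝ)]
  exact_mod_cast add_pow_le_mul_pow_mul_pow_mul_choose r s

lemma exp_mul_binH_add (η : ℝ) {n : ℕ} (hn : 0 < n) (r : ℕ) :
    exp (n * (binH (r / n) + η / 2 * (2 * ((r : ℝ) / n) - 1) ^ 2)) =
      exp (n * binH (r / n)) * exp (η / (2 * n) * (2 * (r : ℝ) - n) ^ 2) := by
  rw [← exp_add]
  congr 1
  field_simp

/-- For every fixed `η ≥ 0`,
`(1/n) log( ∑_{r=0}^n C(n,r) exp((η/(2n))(2r-n)²) ) → sup_{x ∈ [0,1]} { H(x) + (η/2)(2x-1)² }`. -/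
theorem stmt_9 (η : ℝ) (hη : 0 ≤ η) :
    Tendsto (fun n : ℕ =>
        (n : ℝ)⁻¹ * Real.log (∑ r ∈ Finset.range (n + 1),
          (n.choose r : ℝ) * Real.exp (η / (2 * n) * (2 * (r : ℝ) - n) ^ 2)))
      atTop
      (nhds (⨆ x : Set.Icc (0 : ℝ) 1, (binH x + η / 2 * (2 * (x : ℝ) - 1) ^ 2))) := by
  set f : ℝ → ℝ := fun x => binH x + η / 2 * (2 * x - 1) ^ 2 with hf
  have hfc : Continuous f := continuous_binH_add η
  obtain ⟨x, hx, hmax⟩ := isCompact_Icc.exists_isMaxOn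
    (Set.nonempty_Icc.2 (zero_le_one' ℝ)) hfc.continuousOn
  have hsup : (⨆ y : Set.Icc (0 : ℝ) 1, f y) = f x :=
    le_antisymm (ciSup_le fun y => hmax y.2)
      (le_ciSup (f := fun y : Set.Icc (0 : ℝ) 1 => f y)
        ⟨f x, by rintro _ ⟨y, rfl⟩; exact hmax y.2⟩ ⟨x, hx⟩)
  have hlog : Tendsto (fun n : ℕ => (n : ℝ)⁻¹ * log (n + 1)) atTop (nhds 0) := by
    have h := (tendsto_pow_log_div_mul_add_atTop 1 (-1) 1 one_ne_zero).comp
      (tendsto_natCast_atTop_atTop.comp (tendsto_add_atTop_nat 1))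
    refine h.congr fun n => ?_
    simp [div_eq_inv_mul]
  have hfloor : Tendsto (fun n : ℕ => f ((⌊x * n⌋₊ : ℝ) / n)) atTop (nhds (f x)) :=
    (hfc.tendsto x).comp
      ((tendsto_nat_floor_mul_div_atTop hx.1).comp tendsto_natCast_atTop_atTop)
  change Tendsto _ _ (nhds (⨆ y : Set.Icc (0 : ℝ) 1, f y))
  rw [hsup]
  refine tendsto_of_tendsto_of_tendsto_of_le_of_le'
    (by simpa using hfloor.sub hlog) (by simpa using hlog.const_add (f x)) ?_ ?_
  · filter_upwards [eventually_gt_atTop 0] with n hn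
    have hn' : (0 : ℝ) < n := by exact_mod_cast hn
    have hr : ⌊x * n⌋₊ ≤ n := Nat.floor_le_of_le (mul_le_of_le_one_left hn'.le hx.2)
    have hexp : exp (n * f ((⌊x * n⌋₊ : ℝ) / n)) ≤ (n + 1) * ∑ r ∈ Finset.range (n + 1),
        (n.choose r : ℝ) * exp (η / (2 * n) * (2 * (r : ℝ) - n) ^ 2) := by
      rw [hf, exp_mul_binH_add η hn]
      refine (mul_le_mul_of_nonneg_right (exp_mul_binH_le_mul_choose hn hr)
        (exp_nonneg _)).trans ?_
      rw [mul_assoc]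
      refine mul_le_mul_of_nonneg_left ?_ (by positivity)
      exact Finset.single_le_sum
        (f := fun r : ℕ => (n.choose r : ℝ) * exp (η / (2 * n) * (2 * (r : ℝ) - n) ^ 2))
        (fun _ _ => by positivity) (Finset.mem_range.2 (Nat.lt_succ_of_le hr))
    have hS := pos_of_mul_pos_right ((exp_pos _).trans_le hexp) (by positivity)
    have h := log_le_log (exp_pos _) hexp
    rw [log_exp, log_mul (by positivity) hS.ne'] at h
    rw [← mul_le_mul_iff_right₀ hn', mul_sub, mul_inv_cancel_left₀ hn'.ne',
      mul_inv_cancel_left₀ hn'.ne']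
    linarith
  · filter_upwards [eventually_gt_atTop 0] with n hn
    have hn' : (0 : ℝ) < n := by exact_mod_cast hn
    have hexp : ∑ r ∈ Finset.range (n + 1),
        (n.choose r : ℝ) * exp (η / (2 * n) * (2 * (r : ℝ) - n) ^ 2) ≤
          (n + 1) * exp (n * f x) := by
      refine (Finset.sum_le_card_nsmul _ _ (exp (n * f x)) fun r hr => ?_).trans (by simp)
      have hr : r ≤ n := Nat.lt_succ_iff.1 (Finset.mem_range.1 hr)
      have hr' : (r : ℝ) ≤ n := by exact_mod_cast hr
      refine (mul_le_mul_of_nonneg_right (choose_le_exp_mul_binH hn hr)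
        (exp_nonneg _)).trans ?_
      rw [← exp_mul_binH_add η hn]
      refine exp_le_exp.2 (mul_le_mul_of_nonneg_left (hmax ⟨?_, ?_⟩) hn'.le)
      · positivity
      · exact div_le_one_of_le₀ hr' hn'.le
    have hS : 0 < ∑ r ∈ Finset.range (n + 1),
        (n.choose r : ℝ) * exp (η / (2 * n) * (2 * (r : ℝ) - n) ^ 2) :=
      Finset.sum_pos (fun r hr => mul_pos
        (by exact_mod_cast Nat.choose_pos (Nat.lt_succ_iff.1 (Finset.mem_range.1 hr)))
        (exp_pos _)) ⟨0, by simp⟩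
    have h := log_le_log hS hexp
    rw [log_mul (by positivity) (exp_pos _).ne', log_exp] at h
    rw [← mul_le_mul_iff_right₀ hn', mul_add, mul_inv_cancel_left₀ hn'.ne',
      mul_inv_cancel_left₀ hn'.ne']
    linarith
end

section
/- For every η > 0 and every δ > 0 there exists γ > 1 such that inf_{s > η/2} { s − (1 + log 2)/2 − ((1 − γ^{−1})/2) log(s − η/2) − (γ^{−1}/2) log s } ≤ η/2 − 1/2 − (1/2) log η + δ. -/
open Real

/-- For every `η > 0` and `δ > 0` there is `γ > 1` with
`inf_{s > η/2} { s - (1+log 2)/2 - ((1-γ⁻¹)/2) log(s-η/2) - (γ⁻¹/2) log s } ≤ η/2 - 1/2 - (1/2) log η + δ`. -/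
theorem stmt_14 (η δ : ℝ) (hη : 0 < η) (hδ : 0 < δ) :
    ∃ γ : ℝ, 1 < γ ∧
      (⨅ s : {s : ℝ // η / 2 < s}, ((s : ℝ) - (1 + Real.log 2) / 2 -
          ((1 - γ⁻¹) / 2) * Real.log ((s : ℝ) - η / 2) - (γ⁻¹ / 2) * Real.log s)) ≤
        η / 2 - 1 / 2 - (1 / 2) * Real.log η + δ := by
  obtain ⟨t, ht0, ht1, htL⟩ : ∃ t : ℝ, 0 < t ∧ t < 1 ∧
      t * (Real.log (η / 2 + δ / 2) - Real.log (δ / 2)) ≤ δ := by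
    set L := Real.log (η / 2 + δ / 2) - Real.log (δ / 2)
    have hL : 0 ≤ L := sub_nonneg.2 (Real.log_le_log (by positivity) (by linarith))
    refine ⟨δ / (δ + L + 1), by positivity, ?_, ?_⟩
    · rw [div_lt_one (by positivity)]
      linarith
    · rw [div_mul_eq_mul_div, div_le_iff₀ (by positivity)]
      nlinarith
  refine ⟨(1 - t)⁻¹, (one_lt_inv₀ (by linarith)).2 (by linarith), ?_⟩
  rw [inv_inv]
  have hbdd : BddBelow (Set.range fun s : {s : ℝ // η / 2 < s} =>
      ((s : ℝ) - (1 + Real.log 2) / 2 -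
        ((1 - (1 - t)) / 2) * Real.log ((s : ℝ) - η / 2) - ((1 - t) / 2) * Real.log s)) := by
    refine ⟨-(1 + Real.log 2) / 2, ?_⟩
    rintro _ ⟨⟨s, hs⟩, rfl⟩
    have h1 := Real.log_le_sub_one_of_pos (sub_pos.2 hs)
    have h2 := Real.log_le_sub_one_of_pos (show 0 < s by linarith)
    have h3 := mul_le_mul_of_nonneg_left (h1.trans (show s - η / 2 - 1 ≤ s by linarith)) ht0.le
    have h4 := mul_le_mul_of_nonneg_left (h2.trans (show s - 1 ≤ s by linarith))
      (sub_pos.2 ht1).le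
    dsimp only
    linarith
  refine (ciInf_le hbdd ⟨η / 2 + δ / 2, by linarith⟩).trans ?_
  have hlog : Real.log η - Real.log 2 ≤ Real.log (η / 2 + δ / 2) := by
    rw [← Real.log_div hη.ne' two_ne_zero]
    exact Real.log_le_log (by positivity) (by linarith)
  dsimp only
  rw [add_sub_cancel_left]
  linarith
end

section
/- For every real η > 1, one has sup_{x ∈ [0,1]} { H(x) + 2ηx² − 2ηx } + (1/2) log η + 1/2 − log 2 > 0; equivalently, the quantity c_P := η/2 − log 2 + sup_{x ∈ [0,1]} { H(x) + 2ηx² − 2ηx } strictly exceeds c_Q := η/2 − 1/2 − (1/2) log η. -/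
open Real

theorem binH_eq_binEntropy_s15 (x : ℝ) : binH x = Real.binEntropy x := by
  simp only [binH, Real.binEntropy_eq_negMulLog_add_negMulLog_one_sub, Real.negMulLog]
  ring

theorem log_one_add_sub_log_one_sub_lt {m : ℝ} (h0 : 0 < m) (h1 : m < 1) :
    Real.log (1 + m) - Real.log (1 - m) < 1 / (1 - m) - 1 / (1 + m) := by
  have hp : 0 < 1 + m := by linarith
  have hq : 0 < 1 - m := by linarith
  have ht : 1 < (1 + m) / (1 - m) := by rw [lt_div_iff₀ hq]; linarith
  have key := Real.self_lt_sinh_iff.2 (Real.log_pos ht)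
  rw [Real.sinh_log (by positivity), Real.log_div hp.ne' hq.ne'] at key
  convert key using 1
  field_simp
  ring

theorem two_add_mul_log_add_two_sub_mul_log_neg {m : ℝ} (h0 : 0 < m) (h1 : m < 1) :
    (2 + m) * Real.log (1 + m) + (2 - m) * Real.log (1 - m) < 0 := by
  have hderiv : ∀ y ∈ Set.Ico (0 : ℝ) 1, HasDerivAt
      (fun y : ℝ => (2 + y) * Real.log (1 + y) + (2 - y) * Real.log (1 - y))
      (Real.log (1 + y) - Real.log (1 - y) - (1 / (1 - y) - 1 / (1 + y))) y := by
    intro y hy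
    have hp : 1 + y ≠ 0 := by linarith [hy.1]
    have hq : 1 - y ≠ 0 := by linarith [hy.2]
    have hadd := ((hasDerivAt_id y).const_add 2).mul (((hasDerivAt_id y).const_add 1).log hp)
    have hsub := ((hasDerivAt_id y).const_sub 2).mul (((hasDerivAt_id y).const_sub 1).log hq)
    refine (hadd.add hsub).congr_deriv ?_
    simp only [id]
    field_simp
    ring
  have hanti := strictAntiOn_of_deriv_neg (convex_Ico (0 : ℝ) 1)
    (fun y hy => (hderiv y hy).continuousAt.continuousWithinAt) (fun y hy => by
      rw [interior_Ico] at hy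
      rw [(hderiv y ⟨hy.1.le, hy.2⟩).deriv]
      linarith [log_one_add_sub_log_one_sub_lt hy.1 hy.2])
  simpa using hanti ⟨le_rfl, one_pos⟩ ⟨h0.le, h1⟩ h0

theorem binH_one_add_div_two {m : ℝ} (h0 : 0 < m) (h1 : m < 1) :
    binH ((1 + m) / 2) = Real.log 2
      - ((1 + m) * Real.log (1 + m) + (1 - m) * Real.log (1 - m)) / 2 := by
  have hp : 1 + m ≠ 0 := by linarith
  have hq : 1 - m ≠ 0 := by linarith
  rw [binH, show 1 - (1 + m) / 2 = (1 - m) / 2 by ring,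
    Real.log_div hp two_ne_zero, Real.log_div hq two_ne_zero]
  ring

theorem bddAbove_range_binH_add {η : ℝ} (hη : 0 ≤ η) :
    BddAbove (Set.range fun x : Set.Icc (0 : ℝ) 1 =>
      binH x + 2 * η * (x : ℝ) ^ 2 - 2 * η * x) := by
  refine ⟨Real.log 2, ?_⟩
  rintro _ ⟨⟨x, hx0, hx1⟩, rfl⟩
  have hent : binH x ≤ Real.log 2 := binH_eq_binEntropy_s15 x ▸ Real.binEntropy_le_log_two
  have hvar : 0 ≤ η * (x * (1 - x)) :=
    mul_nonneg hη (mul_nonneg hx0 (sub_nonneg.2 hx1))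
  dsimp only
  linarith

/-- For `η > 1`, `sup_{x ∈ [0,1]} { H(x) + 2ηx² - 2ηx } + (1/2) log η + 1/2 - log 2 > 0`;
equivalently `c_P := η/2 - log 2 + sup_{x ∈ [0,1]} { H(x) + 2ηx² - 2ηx }` strictly exceeds
`c_Q := η/2 - 1/2 - (1/2) log η`. -/
theorem stmt_15 (η : ℝ) (hη : 1 < η) :
    0 < (⨆ x : Set.Icc (0 : ℝ) 1, (binH x + 2 * η * (x : ℝ) ^ 2 - 2 * η * x)) +
        (1 / 2) * Real.log η + 1 / 2 - Real.log 2 ∧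
      η / 2 - 1 / 2 - (1 / 2) * Real.log η <
        η / 2 - Real.log 2 +
          (⨆ x : Set.Icc (0 : ℝ) 1, (binH x + 2 * η * (x : ℝ) ^ 2 - 2 * η * x)) := by
  have hη0 : 0 < η := by linarith
  suffices h : Real.log 2 - 1 / 2 - (1 / 2) * Real.log η <
      ⨆ x : Set.Icc (0 : ℝ) 1, (binH x + 2 * η * (x : ℝ) ^ 2 - 2 * η * x) by
    constructor <;> linarith
  have hinv : 0 < 1 - η⁻¹ := sub_pos.2 (inv_lt_one_of_one_lt₀ hη)
  obtain ⟨m, hm0, hm⟩ : ∃ m : ℝ, 0 < m ∧ m ^ 2 = 1 - η⁻¹ :=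
    ⟨√(1 - η⁻¹), Real.sqrt_pos.2 hinv, Real.sq_sqrt hinv.le⟩
  have hm1 : m < 1 := by
    have := inv_pos.2 hη0
    nlinarith
  refine lt_of_lt_of_le ?_ (le_ciSup (bddAbove_range_binH_add hη0.le)
    ⟨(1 + m) / 2, by linarith, by linarith⟩)
  have hquad : η * (1 - m ^ 2) = 1 := by
    rw [hm, sub_sub_cancel, mul_inv_cancel₀ hη0.ne']
  have hlog : Real.log η = -(Real.log (1 + m) + Real.log (1 - m)) := by
    rw [← Real.log_mul (by linarith) (by linarith),
      show (1 + m) * (1 - m) = η⁻¹ by linear_combination -hm, Real.log_inv, neg_neg]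
  have hneg := two_add_mul_log_add_two_sub_mul_log_neg hm0 hm1
  dsimp only
  rw [binH_one_add_div_two hm0 hm1, hlog]
  linarith
end

section
/- For every real η > 1, one has (1/2) log η + H( 1/2 + (1/2)√(1 − 1/η) ) > log 2. -/
open Real

/-- Termwise comparison of power series: `s * artanh s < -log (1 - s ^ 2)` on `(0, 1)`. -/
lemma half_mul_log_sub_log_lt_neg_log_one_sub_sq {s : ℝ} (h0 : 0 < s) (h1 : s < 1) :
    s / 2 * (log (1 + s) - log (1 - s)) < -log (1 - s ^ 2) := by
  have hlog := (hasSum_log_sub_log_of_abs_lt_one (abs_lt.mpr ⟨by linarith, h1⟩)).mul_left (s / 2)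
  have hsq : |s ^ 2| < 1 := by rw [abs_of_pos (by positivity)]; nlinarith
  refine hasSum_lt (i := 1) (fun k => ?_) ?_ hlog (hasSum_pow_div_log_of_abs_lt_one hsq)
  · have hterm : s / 2 * (2 * (1 / (2 * (k : ℝ) + 1)) * s ^ (2 * k + 1)) =
        (s ^ 2) ^ (k + 1) / (2 * k + 1) := by
      field_simp
      ring
    rw [hterm]
    gcongr
    linarith [k.cast_nonneg (α := ℝ)]
  · norm_num
    nlinarith [pow_pos h0 4]

/-- For every `η > 1`, `(1/2) log η + H(1/2 + (1/2)√(1 - 1/η)) > log 2`. -/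
theorem stmt_16 (η : ℝ) (hη : 1 < η) :
    Real.log 2 <
      (1 / 2) * Real.log η + binH (1 / 2 + (1 / 2) * Real.sqrt (1 - 1 / η)) := by
  have hη0 : 0 < η := by linarith
  have hinv : 1 / η < 1 := (div_lt_one hη0).mpr hη
  have hinv0 : 0 < 1 / η := by positivity
  set s := √(1 - 1 / η)
  have hs : s ^ 2 = 1 - 1 / η := sq_sqrt (by linarith)
  have h0 : 0 < s := sqrt_pos.mpr (by linarith)
  have h1 : s < 1 := by nlinarith
  have hlogη : log η = -log (1 - s ^ 2) := by
    rw [hs, sub_sub_cancel, one_div, log_inv, neg_neg]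
  have hprod : log (1 - s ^ 2) = log (1 + s) + log (1 - s) := by
    rw [← log_mul (by linarith) (by linarith)]
    ring_nf
  have hplus : log (1 / 2 + 1 / 2 * s) = log (1 + s) - log 2 := by
    rw [← log_div (by linarith) two_ne_zero]
    ring_nf
  have hminus : log (1 - (1 / 2 + 1 / 2 * s)) = log (1 - s) - log 2 := by
    rw [← log_div (by linarith) two_ne_zero]
    ring_nf
  have key := half_mul_log_sub_log_lt_neg_log_one_sub_sq h0 h1
  rw [binH, hplus, hminus, hlogη]
  rw [hprod] at key ⊢
  linarith
end
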